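/- Let X be an infinite-dimensional real Banach space, and let H(X) denote the collection of all nonempty, closed, bounded, convex subsets of X equipped with the Hausdorff distance d_H. Then there is no Lipschitz selector on H(X): there exists no map ψ : H(X) → X such that ψ(A) ∈ A for every A ∈ H(X) and, for some constant K ≥ 0, ‖ψ(A) − ψ(B)‖ ≤ K · d_H(A,B) for all A, B ∈ H(X). -/

import Mathlib

open Bornology

section helpers
open Filter Topology

theorem avg_exists {G E : Type*} [AddCommMonoid G] [NormedAddCommGroup E] [NormedSpace ℝ E]
    (S : Finset G) (ε : ℝ) (hε : 0 < ε) :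
    ∃ T : (G → E) →ₗ[ℝ] (G → E),
      (∀ C : Set E, Convex ℝ C → ∀ f : G → E, (∀ g, f g ∈ C) → ∀ g, T f g ∈ C) ∧
      (∀ (a : G) (f : G → E), T (fun g => f (g + a)) = fun g => T f (g + a)) ∧
      (∀ s ∈ S, ∀ (B : ℝ) (f : G → E), (∀ g, ‖f g‖ ≤ B) →
        ∀ g, ‖T (fun g => f (g + s)) g - T f g‖ ≤ ε * B) := by
  classical
  induction S using Finset.induction_on with
  | empty => exact ⟨LinearMap.id, fun C _ f h => h, fun a f => rfl, by simp⟩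
  | insert s S hs ih =>
    obtain ⟨T, h1, h2, h3⟩ := ih
    obtain ⟨N, hN⟩ := exists_nat_gt (2 / ε)
    have hN0 : (0 : ℝ) < N := lt_trans (by positivity) hN
    have hNne : (N : ℝ) ≠ 0 := hN0.ne'
    let A : (G → E) →ₗ[ℝ] (G → E) :=
      { toFun := fun f g => ∑ k ∈ Finset.range N, (N : ℝ)⁻¹ • f (g + k • s)
        map_add' := fun f f' => by
          funext g; simp [smul_add, Finset.sum_add_distrib]
        map_smul' := fun c f => by
          funext g; simp [Finset.smul_sum, smul_comm c] }
    have hA : ∀ f g, A f g = ∑ k ∈ Finset.range N, (N : ℝ)⁻¹ • f (g + k • s) := fun f g => rfl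
    have A1 : ∀ C : Set E, Convex ℝ C → ∀ f : G → E, (∀ g, f g ∈ C) → ∀ g, A f g ∈ C := by
      intro C hC f hf g
      rw [hA]
      refine hC.sum_mem (fun _ _ => by positivity) ?_ (fun _ _ => hf _)
      simp [hNne]
    have A2 : ∀ (a : G) (f : G → E), A (fun g => f (g + a)) = fun g => A f (g + a) := by
      intro a f
      funext g
      simp only [hA]
      refine Finset.sum_congr rfl fun k _ => ?_
      rw [add_right_comm]
    have bd : ∀ (T : (G → E) →ₗ[ℝ] (G → E)), (∀ C : Set E, Convex ℝ C → ∀ f : G → E, (∀ g, f g ∈ C) → ∀ g, T f g ∈ C) →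
        ∀ (B : ℝ) (f : G → E), (∀ g, ‖f g‖ ≤ B) → ∀ g, ‖T f g‖ ≤ B := by
      intro T hT B f hf g
      have := hT (Metric.closedBall 0 B) (convex_closedBall _ _) f (fun g => by simpa using hf g) g
      simpa using this
    refine ⟨T ∘ₗ A, fun C hC f hf => h1 C hC _ (A1 C hC f hf), fun a f => ?_, ?_⟩
    · simp only [LinearMap.comp_apply, A2, h2]
    · intro s' hs' B f hf g
      simp only [LinearMap.comp_apply]
      rw [Finset.mem_insert] at hs'
      rcases hs' with rfl | hs'
      · have : T (A fun g => f (g + s')) g - T (A f) g = T ((A fun g => f (g + s')) - A f) g := by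
          rw [map_sub]; rfl
        rw [this]
        refine bd T h1 _ _ (fun g => ?_) g
        have hB : 0 ≤ B := (norm_nonneg _).trans (hf g)
        have e : ((A fun g => f (g + s')) - A f) g = (N : ℝ)⁻¹ • (f (g + N • s') - f g) := by
          rw [Pi.sub_apply, hA, hA, ← Finset.smul_sum, ← Finset.smul_sum, ← smul_sub,
            ← Finset.sum_sub_distrib]
          congr 1
          have := Finset.sum_range_sub (fun k => f (g + k • s')) N
          simp only [zero_smul, add_zero] at this
          rw [← this]
          refine Finset.sum_congr rfl fun k _ => ?_
          rw [add_smul, one_smul, add_assoc]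
        rw [e, norm_smul, norm_inv, Real.norm_natCast]
        have : ‖f (g + N • s') - f g‖ ≤ 2 * B := by
          refine (norm_sub_le _ _).trans ?_
          linarith [hf g, hf (g + N • s')]
        calc (N : ℝ)⁻¹ * ‖f (g + N • s') - f g‖ ≤ (N : ℝ)⁻¹ * (2 * B) := by gcongr
          _ = (2 / N) * B := by field_simp
          _ ≤ ε * B := by
            gcongr
            rw [div_le_iff₀ hN0]
            rw [div_lt_iff₀ hε] at hN
            linarith
      · rw [A2]
        exact h3 s' hs' B (A f) (bd A A1 B f hf) g

theorem mean_exists (G E : Type*) [AddCommMonoid G] [NormedAddCommGroup E] [NormedSpace ℝ E]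
    [ProperSpace E] :
    ∃ M : (G → E) → E,
      (∀ f f' : G → E, (∃ B, ∀ g, ‖f g‖ ≤ B) → (∃ B, ∀ g, ‖f' g‖ ≤ B) →
        M (fun g => f g + f' g) = M f + M f') ∧
      (∀ (a : G) (f : G → E), (∃ B, ∀ g, ‖f g‖ ≤ B) → M (fun g => f (g + a)) = M f) ∧
      (∀ (f : G → E) (B : ℝ), (∀ g, ‖f g‖ ≤ B) → ‖M f‖ ≤ B) ∧
      (∀ x : E, M (fun _ => x) = x) := by
  classical
  have key := fun i : Finset G × ℕ => avg_exists (E := E) i.1 (1 / ((i.2 : ℝ) + 1)) (by positivity)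
  choose T h1 h2 h3 using key
  let U : Ultrafilter (Finset G × ℕ) := Ultrafilter.of atTop
  have hU : (U : Filter (Finset G × ℕ)) ≤ atTop := Ultrafilter.of_le _
  let M : (G → E) → E := fun f => limUnder (U : Filter _) (fun i => T i f 0)
  have bd : ∀ (f : G → E) (B : ℝ), (∀ g, ‖f g‖ ≤ B) → ∀ i g, ‖T i f g‖ ≤ B := by
    intro f B hf i g
    have := h1 i (Metric.closedBall 0 B) (convex_closedBall _ _) f (fun g => by simpa using hf g) g
    simpa using this
  have lim : ∀ f : G → E, (∃ B, ∀ g, ‖f g‖ ≤ B) → Tendsto (fun i => T i f 0) U (𝓝 (M f)) := by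
    rintro f ⟨B, hB⟩
    have hc := isCompact_closedBall (0 : E) B
    have hm : (U.map (fun i => T i f 0) : Filter E) ≤ 𝓟 (Metric.closedBall 0 B) := by
      rw [Ultrafilter.coe_map]
      exact tendsto_principal.2 (Eventually.of_forall fun i => by simpa using bd f B hB i 0)
    obtain ⟨x, _, hx⟩ := hc.ultrafilter_le_nhds _ hm
    exact tendsto_nhds_limUnder ⟨x, hx⟩
  refine ⟨M, ?_, ?_, ?_, ?_⟩
  · rintro f f' ⟨B, hB⟩ ⟨B', hB'⟩
    refine tendsto_nhds_unique (lim _ ⟨B + B', fun g => (norm_add_le _ _).trans (add_le_add (hB g) (hB' g))⟩) ?_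
    have := (lim f ⟨B, hB⟩).add (lim f' ⟨B', hB'⟩)
    refine this.congr fun i => ?_
    have : (fun g => f g + f' g) = f + f' := rfl
    rw [this, map_add]; rfl
  · rintro a f ⟨B, hB⟩
    have l1 := lim f ⟨B, hB⟩
    have l2 := lim (fun g => f (g + a)) ⟨B, fun g => hB _⟩
    have l3 : Tendsto (fun i => T i (fun g => f (g + a)) 0 - T i f 0) U (𝓝 0) := by
      have l4 : Tendsto (fun i : Finset G × ℕ => 1 / ((i.2 : ℝ) + 1) * B) U (𝓝 0) := by
        have : Tendsto (fun i : Finset G × ℕ => i.2) U atTop :=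
          (tendsto_snd.mono_left (by rw [prod_atTop_atTop_eq])).mono_left hU
        have := (tendsto_one_div_add_atTop_nhds_zero_nat (𝕜 := ℝ)).comp this
        simpa using this.mul_const B
      refine squeeze_zero_norm' ?_ l4
      have : ∀ᶠ i : Finset G × ℕ in U, ({a}, 0) ≤ i := hU (eventually_ge_atTop _)
      filter_upwards [this] with i hi
      exact h3 i a (hi.1 (by simp)) B f hB 0
    have := tendsto_nhds_unique l3 (l2.sub l1)
    exact (sub_eq_zero.1 this.symm)
  · intro f B hB
    exact le_of_tendsto (lim f ⟨B, hB⟩).norm (Eventually.of_forall fun i => bd f B hB i 0)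
  · intro x
    refine tendsto_nhds_unique (lim _ ⟨‖x‖, fun _ => le_rfl⟩) ?_
    refine tendsto_const_nhds.congr fun i => ?_
    have := h1 i {x} (convex_singleton x) (fun _ => x) (fun _ => rfl) 0
    exact (Set.mem_singleton_iff.1 this).symm

/-- Continuous sublinear functions on the dual of `E`. -/
def SubL (E : Type*) [NormedAddCommGroup E] [NormedSpace ℝ E] :
    AddSubmonoid (StrongDual ℝ E → ℝ) where
  carrier := {h | Continuous h ∧ (∀ φ θ, h (φ + θ) ≤ h φ + h θ) ∧
    ∀ c : ℝ, 0 ≤ c → ∀ φ, h (c • φ) = c * h φ}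
  zero_mem' := ⟨continuous_const, by simp, by simp⟩
  add_mem' := by
    rintro a b ⟨a1, a2, a3⟩ ⟨b1, b2, b3⟩
    refine ⟨a1.add b1, fun φ θ => ?_, fun c hc φ => ?_⟩
    · have := a2 φ θ
      have := b2 φ θ
      simp only [Pi.add_apply]; linarith
    · simp only [Pi.add_apply, a3 c hc, b3 c hc]; ring

/-- The convex body with a given support function. -/
def bodyOf {E : Type*} [NormedAddCommGroup E] [NormedSpace ℝ E] (h : SubL E) : Set E :=
  {x | ∀ φ : StrongDual ℝ E, φ x ≤ h.1 φ}

set_option linter.unusedSectionVars false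

section sub
variable {E : Type*} [NormedAddCommGroup E] [NormedSpace ℝ E] [FiniteDimensional ℝ E]

theorem SubL.bound (h : SubL E) : ∃ B : ℝ, 0 ≤ B ∧ ∀ φ, |h.1 φ| ≤ B * ‖φ‖ := by
  obtain ⟨h1, h2, h3⟩ := h.2
  have : ProperSpace (StrongDual ℝ E) := FiniteDimensional.proper ℝ _
  obtain ⟨B, hB⟩ := (isCompact_closedBall (0 : StrongDual ℝ E) 1).exists_bound_of_continuousOn
    (f := h.1) h1.continuousOn
  refine ⟨B, (norm_nonneg _).trans (hB 0 (by simp)), fun φ => ?_⟩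
  by_cases hφ : φ = 0
  · have := h3 0 le_rfl 0
    simp only [zero_mul, smul_zero] at this
    simp [hφ, this]
  · have hn : 0 < ‖φ‖ := norm_pos_iff.2 hφ
    have e : φ = ‖φ‖ • (‖φ‖⁻¹ • φ) := by rw [smul_smul, mul_inv_cancel₀ hn.ne', one_smul]
    have := hB (‖φ‖⁻¹ • φ) (by simp [norm_smul, hn.ne'])
    rw [Real.norm_eq_abs] at this
    calc |h.1 φ| = |‖φ‖ * h.1 (‖φ‖⁻¹ • φ)| := by rw [← h3 _ hn.le, ← e]
      _ = ‖φ‖ * |h.1 (‖φ‖⁻¹ • φ)| := by rw [abs_mul, abs_of_pos hn]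
      _ ≤ ‖φ‖ * B := by gcongr
      _ = B * ‖φ‖ := mul_comm _ _

theorem norm_le_of_dual (x : E) (B : ℝ) (hB : 0 ≤ B) (h : ∀ φ : StrongDual ℝ E, φ x ≤ B * ‖φ‖) :
    ‖x‖ ≤ B := by
  obtain ⟨g, hg, hx⟩ := exists_dual_vector'' ℝ x
  have := h g
  rw [hx] at this
  simp only [RCLike.ofReal_real_eq_id, id] at this
  nlinarith

theorem SubL.support (h : SubL E) (φ₀ : StrongDual ℝ E) : ∃ x ∈ bodyOf h, φ₀ x = h.1 φ₀ := by
  obtain ⟨h1, h2, h3⟩ := h.2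
  have h0 : h.1 0 = 0 := by
    have := h3 0 le_rfl 0
    simpa using this
  have main : ∃ g : StrongDual ℝ E →ₗ[ℝ] ℝ, g φ₀ = h.1 φ₀ ∧ ∀ φ, g φ ≤ h.1 φ := by
    by_cases hφ : φ₀ = 0
    · obtain ⟨g, -, hg⟩ := exists_extension_of_le_sublinear (⊥ : StrongDual ℝ E →ₗ.[ℝ] ℝ) h.1
        (fun c hc => h3 c hc.le) h2 (by
          rintro ⟨x, hx⟩
          have hx' : x = 0 := (Submodule.mem_bot ℝ).1 hx
          subst hx'
          have : (⊥ : StrongDual ℝ E →ₗ.[ℝ] ℝ) ⟨0, hx⟩ = 0 := LinearPMap.map_zero _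
          rw [this]
          simp [h0])
      exact ⟨g, by simp [hφ, h0], hg⟩
    · obtain ⟨g, hg', hg⟩ := exists_extension_of_le_sublinear
        (LinearPMap.mkSpanSingleton φ₀ (h.1 φ₀) hφ) h.1
        (fun c hc => h3 c hc.le) h2 (by
          rintro ⟨x, hx⟩
          obtain ⟨c, rfl⟩ := Submodule.mem_span_singleton.1 hx
          erw [LinearPMap.mkSpanSingleton'_apply]
          simp only [RingHom.id_apply, smul_eq_mul]
          rcases le_total 0 c with hc | hc
          · rw [h3 c hc]
          · have a := h3 (-c) (by linarith) φ₀
            have b := h2 (c • φ₀) ((-c) • φ₀)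
            rw [← add_smul, add_neg_cancel, zero_smul, h0] at b
            linarith)
      refine ⟨g, ?_, hg⟩
      have := hg' ⟨(1 : ℝ) • φ₀, Submodule.mem_span_singleton.2 ⟨1, rfl⟩⟩
      erw [LinearPMap.mkSpanSingleton'_apply] at this
      simpa using this
  obtain ⟨g, hg0, hg⟩ := main
  let e : Module.Dual ℝ E ≃ₗ[ℝ] StrongDual ℝ E := LinearMap.toContinuousLinearMap
  let x : E := (Module.evalEquiv ℝ E).symm (g ∘ₗ e.toLinearMap)
  have hx : ∀ φ : StrongDual ℝ E, φ x = g φ := by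
    intro φ
    have h1 : Module.evalEquiv ℝ E x = g ∘ₗ e.toLinearMap := LinearEquiv.apply_symm_apply _ _
    have h2 := LinearMap.congr_fun h1 (e.symm φ)
    rw [Module.evalEquiv_apply] at h2
    simp at h2
    exact h2
  exact ⟨x, fun φ => (hx φ).trans_le (hg φ), by rw [hx, hg0]⟩

theorem bodyOf_closed (h : SubL E) : IsClosed (bodyOf h) := by
  have : bodyOf h = ⋂ φ : StrongDual ℝ E, {x | φ x ≤ h.1 φ} := by
    ext x; simp [bodyOf]
  rw [this]
  exact isClosed_iInter fun φ => isClosed_le φ.continuous continuous_const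

theorem bodyOf_convex (h : SubL E) : Convex ℝ (bodyOf h) := by
  intro x hx y hy a b ha hb hab φ
  have := hx φ
  have := hy φ
  simp only [map_add, map_smul, smul_eq_mul]
  have e : h.1 φ = a * h.1 φ + b * h.1 φ := by rw [← add_mul, hab, one_mul]
  rw [e]
  gcongr

theorem bodyOf_compact (h : SubL E) : IsCompact (bodyOf h) := by
  have : ProperSpace E := FiniteDimensional.proper ℝ _
  obtain ⟨B, hB0, hB⟩ := (SubL.bound h)
  refine Metric.isCompact_of_isClosed_isBounded (bodyOf_closed h) ?_
  refine (Metric.isBounded_closedBall (x := (0 : E)) (r := B)).subset fun x hx => ?_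
  simp only [mem_closedBall_zero_iff]
  exact norm_le_of_dual x B hB0 fun φ => (hx φ).trans ((le_abs_self _).trans (hB φ))

theorem bodyOf_nonempty (h : SubL E) : (bodyOf h).Nonempty :=
  let ⟨x, hx, _⟩ := SubL.support h 0
  ⟨x, hx⟩

theorem bodyOf_near (h g : SubL E) (r : ℝ) (hr : 0 ≤ r)
    (H : ∀ φ, |h.1 φ - g.1 φ| ≤ r * ‖φ‖) (x : E) (hx : x ∈ bodyOf h) :
    ∃ y ∈ bodyOf g, dist x y ≤ r := by
  have : ProperSpace E := FiniteDimensional.proper ℝ _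
  by_contra hcon
  push Not at hcon
  obtain ⟨φ, u, v, h1, huv, h2⟩ := geometric_hahn_banach_closed_compact (bodyOf_convex g)
    (bodyOf_closed g) (convex_closedBall x r) (isCompact_closedBall x r) (by
      rw [Set.disjoint_left]
      intro y hy hy'
      have := hcon y hy
      rw [Metric.mem_closedBall, dist_comm] at hy'
      linarith)
  obtain ⟨a, ha, hag⟩ := SubL.support g φ
  have hga := h1 a ha
  have hv : r * ‖φ‖ ≤ φ x - v := by
    have hxv := h2 x (Metric.mem_closedBall_self hr)
    rcases hr.eq_or_lt with rfl | hr'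
    · simp; linarith
    · have : ‖φ‖ ≤ (φ x - v) / r := by
        refine ContinuousLinearMap.opNorm_le_of_unit_norm (div_nonneg (by linarith) hr) ?_
        intro z hz
        rw [le_div_iff₀ hr', Real.norm_eq_abs]
        have a1 := h2 (x - r • z) (by simp [norm_smul, hz, abs_of_pos hr'])
        have a2 := h2 (x + r • z) (by simp [norm_smul, hz, abs_of_pos hr'])
        simp only [map_sub, map_add, map_smul, smul_eq_mul] at a1 a2
        rcases abs_cases (φ z) with ⟨e, _⟩ | ⟨e, _⟩ <;> rw [e] <;> nlinarith
      rw [le_div_iff₀ hr'] at this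
      linarith
  have := hx φ
  have := (abs_le.1 (H φ)).2
  linarith

/-- evaluation at `x` as a sublinear function -/
def evL (x : E) : SubL E :=
  ⟨fun φ => φ x, by fun_prop, fun φ θ => by simp, fun c _ φ => by simp⟩

theorem evL_add (x y : E) : evL (x + y) = evL x + evL y := by
  ext φ
  simp [evL]

theorem sel_exists {X : Type*} [NormedAddCommGroup X] [NormedSpace ℝ X]
    (ψ : Set X → X) (K : ℝ)
    (hs : ∀ A : Set X, A.Nonempty → IsClosed A → IsBounded A → Convex ℝ A → ψ A ∈ A)
    (hl : ∀ A B : Set X,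
        A.Nonempty → IsClosed A → IsBounded A → Convex ℝ A →
        B.Nonempty → IsClosed B → IsBounded B → Convex ℝ B →
        ‖ψ A - ψ B‖ ≤ K * Metric.hausdorffDist A B) (hK : 0 ≤ K)
    (ι : E →ₗᵢ[ℝ] X) :
    ∃ s : SubL E → E, (∀ (h : SubL E) (φ : StrongDual ℝ E), φ (s h) ≤ h.1 φ) ∧
      ∀ h g : SubL E, ∀ r : ℝ, 0 ≤ r → (∀ φ, |h.1 φ - g.1 φ| ≤ r * ‖φ‖) → ‖s h - s g‖ ≤ K * r := by
  have c1 : ∀ h : SubL E, IsCompact (ι '' bodyOf h) := fun h =>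
    (bodyOf_compact h).image ι.continuous
  have c2 : ∀ h : SubL E, (ι '' bodyOf h).Nonempty := fun h => (bodyOf_nonempty h).image _
  have c3 : ∀ h : SubL E, Convex ℝ (ι '' bodyOf h) := fun h =>
    (bodyOf_convex h).linear_image ι.toLinearMap
  have key : ∀ h : SubL E, ∃ e ∈ bodyOf h, ι e = ψ (ι '' bodyOf h) := fun h =>
    hs _ (c2 h) (c1 h).isClosed (c1 h).isBounded (c3 h)
  choose s s1 s2 using key
  refine ⟨s, fun h φ => s1 h φ, fun h g r hr H => ?_⟩
  rw [← ι.norm_map, map_sub, s2, s2]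
  refine (hl _ _ (c2 h) (c1 h).isClosed (c1 h).isBounded (c3 h) (c2 g) (c1 g).isClosed
    (c1 g).isBounded (c3 g)).trans ?_
  rw [Metric.hausdorffDist_image ι.isometry]
  gcongr
  refine Metric.hausdorffDist_le_of_mem_dist hr (bodyOf_near h g r hr H) ?_
  refine bodyOf_near g h r hr (fun φ => ?_)
  rw [abs_sub_comm]; exact H φ

theorem lin_exists (s : SubL E → E) (K : ℝ) (hs : ∀ (h : SubL E) (φ : StrongDual ℝ E), φ (s h) ≤ h.1 φ)
    (hl : ∀ h g : SubL E, ∀ r : ℝ, 0 ≤ r →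
      (∀ φ, |h.1 φ - g.1 φ| ≤ r * ‖φ‖) → ‖s h - s g‖ ≤ K * r) :
    ∃ f : SubL E → E, (∀ h g, f (h + g) = f h + f g) ∧ (∀ x, f (evL x) = x) ∧
      ∀ h g : SubL E, ∀ r : ℝ, 0 ≤ r → (∀ φ, |h.1 φ - g.1 φ| ≤ r * ‖φ‖) → ‖f h - f g‖ ≤ K * r := by
  have : ProperSpace E := FiniteDimensional.proper ℝ _
  obtain ⟨M, m1, m2, m3, m4⟩ := mean_exists E E
  obtain ⟨M', m1', m2', m3', m4'⟩ := mean_exists (SubL E) E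
  have bsub : ∀ {G : Type _} (u v : G → E), (∃ B, ∀ g, ‖u g‖ ≤ B) → (∃ B, ∀ g, ‖v g‖ ≤ B) →
      ∃ B, ∀ g, ‖u g - v g‖ ≤ B := by
    rintro G u v ⟨B, hB⟩ ⟨B', hB'⟩
    exact ⟨B + B', fun g => (norm_sub_le _ _).trans (add_le_add (hB g) (hB' g))⟩
  have msub : ∀ u v : E → E, (∃ B, ∀ g, ‖u g‖ ≤ B) → (∃ B, ∀ g, ‖v g‖ ≤ B) →
      M u - M v = M (fun g => u g - v g) := by
    intro u v hu hv
    rw [sub_eq_iff_eq_add, ← m1 _ v (bsub u v hu hv) hv]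
    simp
  have msub' : ∀ u v : SubL E → E, (∃ B, ∀ g, ‖u g‖ ≤ B) → (∃ B, ∀ g, ‖v g‖ ≤ B) →
      M' u - M' v = M' (fun g => u g - v g) := by
    intro u v hu hv
    rw [sub_eq_iff_eq_add, ← m1' _ v (bsub u v hu hv) hv]
    simp
  have b1 : ∀ h : SubL E, ∃ B, ∀ x, ‖s (h + evL x) - x‖ ≤ B := by
    intro h
    obtain ⟨B, hB0, hB⟩ := (SubL.bound h)
    refine ⟨B, fun x => norm_le_of_dual _ B hB0 fun φ => ?_⟩
    have a := hs (h + evL x) φ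
    have : (h + evL x).1 φ = h.1 φ + φ x := rfl
    rw [map_sub]
    linarith [hB φ, le_abs_self (h.1 φ)]
  let t : SubL E → E := fun h => M (fun x => s (h + evL x) - x)
  have t1 : ∀ h x, t (evL x + h) = x + t h := by
    intro h x
    show M _ = x + M _
    rw [← m2 x _ (b1 h)]
    have := m1 (fun _ => x) (fun g => s (h + evL (g + x)) - (g + x)) ⟨‖x‖, fun _ => le_rfl⟩
      (let ⟨B, hB⟩ := b1 h; ⟨B, fun g => hB (g + x)⟩)
    rw [m4] at this
    rw [← this]
    congr 1
    funext g
    rw [evL_add]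
    have e : evL x + h + evL g = h + (evL g + evL x) := by abel
    rw [e]; abel
  have t2 : ∀ h g : SubL E, ∀ r : ℝ, 0 ≤ r → (∀ φ, |h.1 φ - g.1 φ| ≤ r * ‖φ‖) →
      ‖t h - t g‖ ≤ K * r := by
    intro h g r hr H
    show ‖M _ - M _‖ ≤ _
    rw [msub _ _ (b1 h) (b1 g)]
    refine m3 _ _ fun x => ?_
    rw [sub_sub_sub_cancel_right]
    refine hl _ _ r hr fun φ => ?_
    have : (h + evL x).1 φ - (g + evL x).1 φ = h.1 φ - g.1 φ := by
      show h.1 φ + φ x - (g.1 φ + φ x) = _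
      ring
    rw [this]; exact H φ
  have b2 : ∀ h : SubL E, ∃ B, ∀ g, ‖t (h + g) - t g‖ ≤ B := by
    intro h
    obtain ⟨B, hB0, hB⟩ := (SubL.bound h)
    refine ⟨K * B, fun g => t2 _ _ B hB0 fun φ => ?_⟩
    have : (h + g).1 φ - g.1 φ = h.1 φ := by
      show h.1 φ + g.1 φ - g.1 φ = _
      ring
    rw [this]; exact hB φ
  refine ⟨fun h => M' (fun g => t (h + g) - t g), ?_, ?_, ?_⟩
  · intro h g
    show M' _ = M' _ + M' _
    rw [← m2' g _ (b2 h), ← m1' _ _ (let ⟨B, hB⟩ := b2 h; ⟨B, fun g' => hB (g' + g)⟩) (b2 g)]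
    congr 1
    funext g'
    have e : h + g + g' = h + (g' + g) := by abel
    rw [e, add_comm g g']; abel
  · intro x
    show M' _ = x
    simp only [t1, add_sub_cancel_right, m4']
  · intro h g r hr H
    show ‖M' _ - M' _‖ ≤ _
    rw [msub' _ _ (b2 h) (b2 g)]
    refine m3' _ _ fun x => ?_
    rw [sub_sub_sub_cancel_right]
    refine t2 _ _ r hr fun φ => ?_
    have : (h + x).1 φ - (g + x).1 φ = h.1 φ - g.1 φ := by
      show h.1 φ + x.1 φ - (g.1 φ + x.1 φ) = _
      ring
    rw [this]; exact H φ

end sub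

theorem ext_dense {Y E S : Type*} [NormedAddCommGroup Y] [NormedSpace ℝ Y] [NormedAddCommGroup E]
    [NormedSpace ℝ E] [CompleteSpace E] [AddCommMonoid S] (r : S → Y) (f : S → E)
    (r1 : ∀ h g, r (h + g) = r h + r g) (f1 : ∀ h g, f (h + g) = f h + f g) (K : ℝ)
    (lip : ∀ h g, ‖f h - f g‖ ≤ K * ‖r h - r g‖)
    (D : Submodule ℝ Y) (hD0 : ∀ d ∈ D, ∃ h g, d = r h - r g) (hD1 : ∀ h g, r h - r g ∈ D)
    (hD : closure (D : Set Y) = ⊤) :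
    ∃ P : Y →ₗ[ℝ] E, (∀ g, ‖P g‖ ≤ K * ‖g‖) ∧ ∀ h g, P (r h - r g) = f h - f g := by
  have wd : ∀ h g h' g' : S, r h - r g = r h' - r g' →
      f h - f g = f h' - f g' := by
    intro h g h' g' e
    have := lip (h + g') (h' + g)
    have e' : r (h + g') - r (h' + g) = 0 := by
      rw [r1, r1]
      have : r h + r g' - (r h' + r g) = (r h - r g) - (r h' - r g') := by
        abel
      rw [this, e, sub_self]
    rw [e', norm_zero, mul_zero] at this
    have := norm_le_zero_iff.1 this
    rw [f1, f1, sub_eq_zero] at this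
    rw [sub_eq_sub_iff_add_eq_add, this]
  have hd : ∀ d : D, ∃ h g : S, d.1 = r h - r g := fun d => hD0 _ d.2
  choose H G hHG using hd
  let F0 : D →+ E := AddMonoidHom.mk' (fun d => f (H d) - f (G d)) (by
    intro d d'
    have := wd (H (d + d')) (G (d + d')) (H d + H d') (G d + G d') (by
      rw [← hHG, r1, r1, add_sub_add_comm, ← hHG, ← hHG]; rfl)
    rw [this, f1, f1]; abel)
  have F0b : ∀ d, ‖F0 d‖ ≤ K * ‖d‖ := fun d => by
    refine (lip (H d) (G d)).trans_eq ?_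
    rw [← hHG]; rfl
  have F0c : Continuous F0 := AddMonoidHomClass.continuous_of_bound F0 K F0b
  let F1 : D →L[ℝ] E := F0.toRealLinearMap F0c
  have dn : DenseRange D.subtype := by
    rw [DenseRange, dense_iff_closure_eq]
    have : Set.range D.subtype = (D : Set Y) := by simp
    rw [this]; exact hD
  refine ⟨(F1.toLinearMap.extendOfNorm D.subtype).toLinearMap,
    LinearMap.norm_extendOfNorm_apply_le dn K F0b, fun h g => ?_⟩
  refine Eq.trans (LinearMap.extendOfNorm_eq (f := F1.toLinearMap) (e := D.subtype) dn ⟨K, F0b⟩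
    ⟨r h - r g, hD1 h g⟩) ?_
  exact wd _ _ _ _ (hHG _).symm

theorem ext_denseC {Ω E S : Type*} [TopologicalSpace Ω] [CompactSpace Ω] [NormedAddCommGroup E]
    [NormedSpace ℝ E] [CompleteSpace E] [AddCommMonoid S] (r : S → C(Ω, ℝ)) (f : S → E)
    (r1 : ∀ h g, r (h + g) = r h + r g) (f1 : ∀ h g, f (h + g) = f h + f g) (K : ℝ)
    (lip : ∀ h g, ‖f h - f g‖ ≤ K * ‖r h - r g‖)
    (D : Submodule ℝ C(Ω, ℝ)) (hD0 : ∀ d ∈ D, ∃ h g, d = r h - r g) (hD1 : ∀ h g, r h - r g ∈ D)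
    (hD : closure (D : Set C(Ω, ℝ)) = ⊤) :
    ∃ P : C(Ω, ℝ) →ₗ[ℝ] E, (∀ g, ‖P g‖ ≤ K * ‖g‖) ∧ ∀ h g, P (r h - r g) = f h - f g :=
  ext_dense (Y := C(Ω, ℝ)) r f r1 f1 K lip D hD0 hD1 hD

section linop
variable {E : Type*} [NormedAddCommGroup E] [NormedSpace ℝ E] [FiniteDimensional ℝ E]

/-- restriction of a sublinear function to the dual sphere -/
def resL (h : SubL E) : C(Metric.sphere (0 : StrongDual ℝ E) 1, ℝ) :=
  ⟨fun φ => h.1 φ.1, h.2.1.comp continuous_subtype_val⟩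

/-- evaluation at a vector as a function on the dual sphere -/
def evC (x : E) : C(Metric.sphere (0 : StrongDual ℝ E) 1, ℝ) :=
  ⟨fun φ => φ.1 x, by fun_prop⟩

theorem resL_add (h g : SubL E) : resL (h + g) = resL h + resL g := rfl

theorem SubL.le_of_resL (h g : SubL E) (φ : StrongDual ℝ E) :
    |h.1 φ - g.1 φ| ≤ ‖resL h - resL g‖ * ‖φ‖ := by
  by_cases hφ : φ = 0
  · have a := h.2.2.2 0 le_rfl 0
    have b := g.2.2.2 0 le_rfl 0
    simp only [zero_mul, smul_zero] at a b
    simp [hφ, a, b]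
  · have hn : 0 < ‖φ‖ := norm_pos_iff.2 hφ
    have e : φ = ‖φ‖ • (‖φ‖⁻¹ • φ) := by rw [smul_smul, mul_inv_cancel₀ hn.ne', one_smul]
    have := (resL h - resL g).norm_coe_le_norm ⟨‖φ‖⁻¹ • φ, by simp [norm_smul, hn.ne']⟩
    rw [Real.norm_eq_abs] at this
    have this : |h.1 (‖φ‖⁻¹ • φ) - g.1 (‖φ‖⁻¹ • φ)| ≤ ‖resL h - resL g‖ := this
    calc |h.1 φ - g.1 φ| = |‖φ‖ * h.1 (‖φ‖⁻¹ • φ) - ‖φ‖ * g.1 (‖φ‖⁻¹ • φ)| := by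
          rw [← h.2.2.2 _ hn.le, ← g.2.2.2 _ hn.le, ← e]
      _ = ‖φ‖ * |h.1 (‖φ‖⁻¹ • φ) - g.1 (‖φ‖⁻¹ • φ)| := by rw [← mul_sub, abs_mul, abs_of_pos hn]
      _ ≤ ‖φ‖ * ‖resL h - resL g‖ := by gcongr
      _ = _ := mul_comm _ _

/-- nonnegative multiples -/
def SubL.nsm (c : ℝ) (hc : 0 ≤ c) (h : SubL E) : SubL E :=
  ⟨fun φ => c * h.1 φ, continuous_const.mul h.2.1,
    fun φ θ => by rw [← mul_add]; exact mul_le_mul_of_nonneg_left (h.2.2.1 φ θ) hc,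
    fun d hd φ => by beta_reduce; rw [h.2.2.2 d hd]; ring⟩

/-- maxima -/
def SubL.mx (h g : SubL E) : SubL E :=
  ⟨fun φ => max (h.1 φ) (g.1 φ), h.2.1.max g.2.1,
    fun φ θ => max_le ((h.2.2.1 φ θ).trans (add_le_add (le_max_left _ _) (le_max_left _ _)))
      ((g.2.2.1 φ θ).trans (add_le_add (le_max_right _ _) (le_max_right _ _))),
    fun d hd φ => by beta_reduce; rw [h.2.2.2 d hd, g.2.2.2 d hd, mul_max_of_nonneg _ _ hd]⟩

/-- the norm -/
noncomputable def SubL.nrm : SubL E :=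
  ⟨fun φ => ‖φ‖, continuous_norm, norm_add_le, fun d hd φ => by
    beta_reduce; rw [norm_smul, Real.norm_of_nonneg hd]⟩

/-- differences of sublinear functions on the dual sphere -/
def dcL (E : Type*) [NormedAddCommGroup E] [NormedSpace ℝ E] [FiniteDimensional ℝ E] :
    Submodule ℝ C(Metric.sphere (0 : StrongDual ℝ E) 1, ℝ) where
  carrier := {d | ∃ h g : SubL E, d = resL h - resL g}
  zero_mem' := ⟨0, 0, by simp⟩
  add_mem' := by
    rintro _ _ ⟨h, g, rfl⟩ ⟨h', g', rfl⟩
    exact ⟨h + h', g + g', by simp only [resL_add]; abel⟩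
  smul_mem' := by
    rintro c _ ⟨h, g, rfl⟩
    rcases le_total 0 c with hc | hc
    · refine ⟨SubL.nsm c hc h, SubL.nsm c hc g, ?_⟩
      ext φ
      show c * (h.1 φ.1 - g.1 φ.1) = c * h.1 φ.1 - c * g.1 φ.1
      ring
    · refine ⟨SubL.nsm (-c) (by linarith) g, SubL.nsm (-c) (by linarith) h, ?_⟩
      ext φ
      show c * (h.1 φ.1 - g.1 φ.1) = -c * g.1 φ.1 - -c * h.1 φ.1
      ring

theorem dcL_sup {d d' : C(Metric.sphere (0 : StrongDual ℝ E) 1, ℝ)} (hd : d ∈ dcL E)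
    (hd' : d' ∈ dcL E) : d ⊔ d' ∈ dcL E := by
  obtain ⟨h, g, rfl⟩ := hd
  obtain ⟨h', g', rfl⟩ := hd'
  refine ⟨SubL.mx (h + g') (h' + g), g + g', ?_⟩
  ext φ
  show max (h.1 φ.1 - g.1 φ.1) (h'.1 φ.1 - g'.1 φ.1) =
    max (h.1 φ.1 + g'.1 φ.1) (h'.1 φ.1 + g.1 φ.1) - (g.1 φ.1 + g'.1 φ.1)
  rw [← max_sub_sub_right]
  congr 1 <;> ring

theorem dcL_ev (x : E) : evC x ∈ dcL E := ⟨evL x, 0, by ext φ; simp [evC, resL, evL]⟩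

theorem dcL_one : (1 : C(Metric.sphere (0 : StrongDual ℝ E) 1, ℝ)) ∈ dcL E :=
  ⟨SubL.nrm, 0, by
    ext φ
    show 1 = ‖φ.1‖ - 0
    have := φ.2
    rw [mem_sphere_zero_iff_norm] at this
    rw [this, sub_zero]⟩

theorem dcL_dense : closure (dcL E : Set C(Metric.sphere (0 : StrongDual ℝ E) 1, ℝ)) = ⊤ := by
  refine ContinuousMap.sublattice_closure_eq_top _ ⟨0, (dcL E).zero_mem⟩ ?_ ?_ ?_
  · intro f hf g hg
    have : f ⊓ g = -((-f) ⊔ (-g)) := by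
      ext φ
      show min (f φ) (g φ) = - max (- f φ) (- g φ)
      rw [max_neg_neg, neg_neg]
    rw [this]
    exact (dcL E).neg_mem (dcL_sup ((dcL E).neg_mem hf) ((dcL E).neg_mem hg))
  · intro f hf g hg
    exact dcL_sup hf hg
  · intro v φ θ
    by_cases hne : φ = θ
    · subst hne
      exact ⟨v φ • 1, (dcL E).smul_mem _ dcL_one, by simp, by simp⟩
    · have : ∃ x, φ.1 x ≠ θ.1 x := by
        by_contra hcon
        push Not at hcon
        exact hne (Subtype.ext (ContinuousLinearMap.ext hcon))
      obtain ⟨x, hx⟩ := this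
      have hx' : φ.1 x - θ.1 x ≠ 0 := sub_ne_zero.2 hx
      refine ⟨v φ • 1 + ((v φ - v θ) / (φ.1 x - θ.1 x)) • (evC x - φ.1 x • 1),
        (dcL E).add_mem ((dcL E).smul_mem _ dcL_one) ((dcL E).smul_mem _
          ((dcL E).sub_mem (dcL_ev x) ((dcL E).smul_mem _ dcL_one))), ?_, ?_⟩
      · simp [evC]
      · simp [evC]
        field_simp
        ring

theorem proj_exists (f : SubL E → E) (K : ℝ) (f1 : ∀ h g, f (h + g) = f h + f g)
    (f2 : ∀ x, f (evL x) = x)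
    (f3 : ∀ h g : SubL E, ∀ r : ℝ, 0 ≤ r → (∀ φ, |h.1 φ - g.1 φ| ≤ r * ‖φ‖) →
      ‖f h - f g‖ ≤ K * r) :
    ∃ P : C(Metric.sphere (0 : StrongDual ℝ E) 1, ℝ) →ₗ[ℝ] E,
      (∀ g, ‖P g‖ ≤ K * ‖g‖) ∧ ∀ x, P (evC x) = x := by
  have lip : ∀ h g : SubL E, ‖f h - f g‖ ≤ K * ‖resL h - resL g‖ := fun h g =>
    f3 h g _ (norm_nonneg (resL h - resL g)) (SubL.le_of_resL h g)
  obtain ⟨Q, Q1, Q2⟩ := ext_denseC (Ω := Metric.sphere (0 : StrongDual ℝ E) 1) resL f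
    resL_add f1 K lip (dcL E) (fun d hd => hd) (fun h g => ⟨h, g, rfl⟩) dcL_dense
  refine ⟨Q, Q1, fun x => ?_⟩
  have e : evC x = resL (evL x) - resL 0 := by ext φ; simp [evC, resL, evL]
  rw [e, Q2, f2]
  have : f 0 = 0 := by
    have := f1 0 0
    simpa using this
  rw [this, sub_zero]

end linop

universe uE
theorem proj_exists2 {X : Type*} [NormedAddCommGroup X] [NormedSpace ℝ X]
    (ψ : Set X → X) (K : ℝ) (hK : 0 ≤ K)
    (hs : ∀ A : Set X, A.Nonempty → IsClosed A → IsBounded A → Convex ℝ A → ψ A ∈ A)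
    (hl : ∀ A B : Set X,
        A.Nonempty → IsClosed A → IsBounded A → Convex ℝ A →
        B.Nonempty → IsClosed B → IsBounded B → Convex ℝ B →
        ‖ψ A - ψ B‖ ≤ K * Metric.hausdorffDist A B)
    {E : Type uE} [NormedAddCommGroup E] [NormedSpace ℝ E] [FiniteDimensional ℝ E]
    (ι : E →ₗᵢ[ℝ] X) :
    ∃ (Ω : Type uE) (_ : TopologicalSpace Ω) (_ : CompactSpace Ω) (j : Ω → StrongDual ℝ E)
      (ev : E → C(Ω, ℝ)) (P : C(Ω, ℝ) →ₗ[ℝ] E), (∀ ω, ‖j ω‖ = 1) ∧ (∀ x ω, ev x ω = j ω x) ∧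
      (∀ g, ‖P g‖ ≤ K * ‖g‖) ∧ ∀ x, P (ev x) = x := by
  obtain ⟨s, s1, s2⟩ := sel_exists ψ K hs hl hK ι
  obtain ⟨f, f1, f2, f3⟩ := lin_exists s K s1 s2
  obtain ⟨P, P1, P2⟩ := proj_exists f K f1 f2 f3
  refine ⟨Metric.sphere (0 : StrongDual ℝ E) 1, inferInstance, inferInstance, Subtype.val, evC, P,
    fun ω => ?_, fun x ω => rfl, P1, P2⟩
  simp

/-- sign of a boolean -/
def sg (b : Bool) : ℝ := if b then 1 else -1

theorem sg_sq (b : Bool) : sg b * sg b = 1 := by cases b <;> simp [sg]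

/-- Riesz products -/
noncomputable def riesz {Ω ι : Type*} [Fintype ι] [TopologicalSpace Ω] (t : ι → C(Ω, ℝ))
    (ε : ι → Bool) : C(Ω, ℝ) :=
  ⟨fun ω => (∏ j, (1 + Complex.I * ((sg (ε j) * t j ω : ℝ) : ℂ))).im, by fun_prop⟩

theorem riesz_bound {Ω ι : Type*} [Fintype ι] [TopologicalSpace Ω] [CompactSpace Ω]
    (t : ι → C(Ω, ℝ)) (ht : ∀ ω, ∑ j, (t j ω) ^ 2 ≤ 1) (ε : ι → Bool) : ‖riesz t ε‖ ≤ 2 := by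
  rw [ContinuousMap.norm_le _ (by norm_num)]
  intro ω
  rw [Real.norm_eq_abs]
  refine (Complex.abs_im_le_norm _).trans ?_
  have h2 : ‖∏ j, (1 + Complex.I * ((sg (ε j) * t j ω : ℝ) : ℂ))‖ ^ 2 ≤ 4 := by
    rw [norm_prod, ← Finset.prod_pow]
    calc ∏ j, ‖(1 + Complex.I * ((sg (ε j) * t j ω : ℝ) : ℂ))‖ ^ 2
        ≤ ∏ j, Real.exp ((t j ω) ^ 2) := by
          refine Finset.prod_le_prod (fun _ _ => by positivity) fun j _ => ?_
          rw [← Complex.normSq_eq_norm_sq, Complex.normSq_apply]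
          have h : sg (ε j) * t j ω * (sg (ε j) * t j ω) = (t j ω) ^ 2 := by
            rw [mul_mul_mul_comm, sg_sq]; ring
          have := Real.add_one_le_exp ((t j ω) ^ 2)
          simp only [Complex.add_re, Complex.one_re, Complex.mul_re, Complex.I_re, Complex.ofReal_re,
            Complex.I_im, Complex.ofReal_im, Complex.add_im, Complex.one_im, Complex.mul_im]
          ring_nf at h ⊢
          linarith
      _ = Real.exp (∑ j, (t j ω) ^ 2) := (Real.exp_sum _ _).symm
      _ ≤ Real.exp 1 := Real.exp_le_exp.2 (ht ω)
      _ ≤ 4 := by have := Real.exp_one_lt_d9; linarith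
  nlinarith [norm_nonneg (∏ j, (1 + Complex.I * ((sg (ε j) * t j ω : ℝ) : ℂ)))]

theorem riesz_avg {Ω ι : Type*} [Fintype ι] [DecidableEq ι] [TopologicalSpace Ω]
    (t : ι → C(Ω, ℝ)) (k : ι) :
    ∑ ε : ι → Bool, sg (ε k) • riesz t ε = (2 : ℝ) ^ (Fintype.card ι) • t k := by
  ext ω
  have key : ∑ ε : ι → Bool, (sg (ε k) : ℂ) *
      ∏ j, (1 + Complex.I * ((sg (ε j) * t j ω : ℝ) : ℂ)) =
      Complex.I * (((2 : ℝ) ^ (Fintype.card ι) * t k ω : ℝ) : ℂ) := by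
    let h : ι → Bool → ℂ := fun j b => (if j = k then (sg b : ℂ) else 1) *
      (1 + Complex.I * ((sg b * t j ω : ℝ) : ℂ))
    have e : ∀ ε : ι → Bool, (sg (ε k) : ℂ) *
      ∏ j, (1 + Complex.I * ((sg (ε j) * t j ω : ℝ) : ℂ)) = ∏ j, h j (ε j) := by
      intro ε
      simp only [h]
      rw [Finset.prod_mul_distrib, Finset.prod_ite_eq' Finset.univ k (fun j => (sg (ε j) : ℂ))]
      simp
    simp only [e]
    have p := Finset.prod_univ_sum (fun _ : ι => (Finset.univ : Finset Bool)) h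
    rw [Fintype.piFinset_univ] at p
    rw [← p]
    have q : ∀ j, ∑ b, h j b = 2 * (if j = k then Complex.I * (t k ω : ℂ) else 1) := by
      intro j
      by_cases hj : j = k
      · subst hj
        simp [h, sg]; ring
      · simp [h, sg, hj]; ring
    simp only [q]
    rw [Finset.prod_mul_distrib, Finset.prod_ite_eq' Finset.univ k (fun _ => Complex.I * (t k ω : ℂ))]
    simp
    ring
  have := congrArg Complex.im key
  rw [Complex.I_mul_im, Complex.ofReal_re, Complex.im_sum] at this
  simp only [Complex.im_ofReal_mul] at this
  simpa [riesz] using this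

theorem main_lemma {X : Type*} [NormedAddCommGroup X] [NormedSpace ℝ X]
    (ψ : Set X → X) (K : ℝ) (hK : 0 ≤ K)
    (hs : ∀ A : Set X, A.Nonempty → IsClosed A → IsBounded A → Convex ℝ A → ψ A ∈ A)
    (hl : ∀ A B : Set X,
        A.Nonempty → IsClosed A → IsBounded A → Convex ℝ A →
        B.Nonempty → IsClosed B → IsBounded B → Convex ℝ B →
        ‖ψ A - ψ B‖ ≤ K * Metric.hausdorffDist A B)
    {ι : Type*} [Fintype ι] [DecidableEq ι] (z : ι → X) (hz : ∀ j, z j ≠ 0) (U : ℝ) (hU0 : 0 ≤ U)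
    (hU : ∀ (ε : ι → Bool) (c : ι → ℝ), ‖∑ j, (sg (ε j) * c j) • z j‖ ≤ U * ‖∑ j, c j • z j‖)
    (a : ι → ℝ) (ha : ∀ φ : StrongDual ℝ X, ‖φ‖ ≤ 1 → ∑ j, (a j * φ (z j)) ^ 2 ≤ 1) :
    ‖∑ j, a j • z j‖ ≤ 2 * K * U := by
  have li : LinearIndependent ℝ z := by
    rw [Fintype.linearIndependent_iff]
    intro c hc k
    have h1 := hU (fun j => decide (j = k)) c
    rw [hc, norm_zero, mul_zero] at h1
    have h1 := norm_le_zero_iff.1 h1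
    have h2 : ∑ j, ((sg (decide (j = k)) * c j) • z j + c j • z j) = 0 := by
      rw [Finset.sum_add_distrib, h1, hc, add_zero]
    have h3 : ∀ j, ((sg (decide (j = k)) * c j) • z j + c j • z j) =
        if j = k then (2 * c j) • z j else 0 := by
      intro j
      by_cases hj : j = k
      · simp only [hj, decide_true, sg, if_true, one_mul]
        rw [← add_smul]; congr 1; ring
      · simp [hj, sg]
    simp only [h3, Finset.sum_ite_eq', Finset.mem_univ, if_true] at h2
    rcases smul_eq_zero.1 h2 with h | h
    · linarith
    · exact absurd h (hz k)
  let E := Submodule.span ℝ (Set.range z)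
  have fd : FiniteDimensional ℝ E := FiniteDimensional.span_of_finite ℝ (Set.finite_range z)
  let B : Module.Basis ι ℝ E := Module.Basis.span li
  have hB : ∀ j, ((B j : E) : X) = z j := fun j => congrArg Subtype.val (Module.Basis.span_apply li j)
  obtain ⟨Ω, i1, i2, J, ev, P, J1, J2, P1, P2⟩ := proj_exists2 ψ K hK hs hl E.subtypeₗᵢ
  let t : ι → C(Ω, ℝ) := fun j => ev (a j • B j)
  have ht : ∀ ω, ∑ j, (t j ω) ^ 2 ≤ 1 := by
    intro ω
    obtain ⟨φ, hφ, hφn⟩ := exists_extension_norm_eq E (J ω)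
    have := ha φ (by rw [hφn, J1])
    convert this using 3 with j
    simp only [t, J2, map_smul, smul_eq_mul]
    rw [← hφ, hB]
  let T : (ι → Bool) → E → E := fun ε x => ∑ k, sg (ε k) • (B.coord k x • B k)
  have hT : ∀ ε x, ‖T ε x‖ ≤ U * ‖x‖ := by
    intro ε x
    have h := hU ε (fun k => B.coord k x)
    have e1 : ((T ε x : E) : X) = ∑ j, (sg (ε j) * B.coord j x) • z j := by
      simp only [T, Submodule.coe_sum, Submodule.coe_smul, hB, smul_smul]
    have e2 : (x : X) = ∑ j, B.coord j x • z j := by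
      conv_lhs => rw [← B.sum_repr x]
      simp only [Submodule.coe_sum, Submodule.coe_smul, hB, Module.Basis.coord_apply]
    rw [← e1, ← e2] at h
    exact h
  have hav : ∑ ε, T ε (P (riesz t ε)) = (2 : ℝ) ^ (Fintype.card ι) • ∑ k, a k • B k := by
    simp only [T]
    rw [Finset.sum_comm, Finset.smul_sum]
    refine Finset.sum_congr rfl fun k _ => ?_
    have : B.coord k (P (∑ ε : ι → Bool, sg (ε k) • riesz t ε)) = 
        (2 : ℝ) ^ (Fintype.card ι) * a k := by
      rw [riesz_avg, map_smul, P2, map_smul, map_smul]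
      simp
    rw [map_sum, map_sum] at this
    simp only [map_smul, smul_eq_mul] at this
    rw [smul_smul, ← this, Finset.sum_smul]
    simp only [smul_smul]
  have hn : ‖∑ ε, T ε (P (riesz t ε))‖ ≤ (2 : ℝ) ^ (Fintype.card ι) * (2 * K * U) := by
    calc ‖∑ ε, T ε (P (riesz t ε))‖ ≤ ∑ ε : ι → Bool, ‖T ε (P (riesz t ε))‖ := norm_sum_le _ _
      _ ≤ ∑ ε : ι → Bool, U * (K * 2) := by
          refine Finset.sum_le_sum fun ε _ => (hT _ _).trans ?_
          gcongr
          exact (P1 _).trans (by gcongr; exact riesz_bound t ht ε)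
      _ = _ := by simp; ring
  rw [hav, norm_smul, Real.norm_of_nonneg (by positivity)] at hn
  have := le_of_mul_le_mul_left hn (by positivity)
  have e : ∑ j, a j • z j = ((∑ k, a k • B k : E) : X) := by
    simp only [Submodule.coe_sum, Submodule.coe_smul, hB]
  rw [e]; exact this

theorem main_cor {X : Type*} [NormedAddCommGroup X] [NormedSpace ℝ X]
    (ψ : Set X → X) (K : ℝ) (hK : 0 ≤ K)
    (hs : ∀ A : Set X, A.Nonempty → IsClosed A → IsBounded A → Convex ℝ A → ψ A ∈ A)
    (hl : ∀ A B : Set X,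
        A.Nonempty → IsClosed A → IsBounded A → Convex ℝ A →
        B.Nonempty → IsClosed B → IsBounded B → Convex ℝ B →
        ‖ψ A - ψ B‖ ≤ K * Metric.hausdorffDist A B)
    {ι : Type*} [Fintype ι] [DecidableEq ι] (z : ι → X) (hz : ∀ j, z j ≠ 0)
    (hz1 : ∀ j, ‖z j‖ ≤ 1) (U : ℝ) (hU0 : 0 ≤ U)
    (hU : ∀ (ε : ι → Bool) (c : ι → ℝ), ‖∑ j, (sg (ε j) * c j) • z j‖ ≤ U * ‖∑ j, c j • z j‖) :
    ‖∑ j, z j‖ ≤ (2 * K * U + 1) ^ 2 := by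
  set C := 2 * K * U + 1 with hC
  have hC1 : 0 < C := by positivity
  have s1 : ∀ a : ι → ℝ, ∑ j, (a j) ^ 2 ≤ 1 → ‖∑ j, a j • z j‖ ≤ C := by
    intro a ha
    refine (main_lemma ψ K hK hs hl z hz U hU0 hU a fun φ hφ => ?_).trans (by linarith)
    refine (Finset.sum_le_sum fun j _ => ?_).trans ha
    have : |φ (z j)| ≤ 1 := by
      have := φ.le_opNorm (z j)
      rw [Real.norm_eq_abs] at this
      nlinarith [hz1 j, norm_nonneg (z j), norm_nonneg φ]
    rw [mul_pow]
    have : φ (z j) ^ 2 ≤ 1 := by rw [← sq_abs]; nlinarith [abs_nonneg (φ (z j))]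
    nlinarith [sq_nonneg (a j)]
  have s2 : ∀ φ : StrongDual ℝ X, ‖φ‖ ≤ 1 → ∑ j, (φ (z j)) ^ 2 ≤ C ^ 2 := by
    intro φ hφ
    set S := ∑ j, (φ (z j)) ^ 2 with hS
    have S0 : 0 ≤ S := Finset.sum_nonneg fun _ _ => sq_nonneg _
    rcases S0.eq_or_lt with h | h
    · rw [← h]; positivity
    have hq : 0 < √S := Real.sqrt_pos.2 h
    have hq2 : √S ^ 2 = S := Real.sq_sqrt S0
    have := s1 (fun j => φ (z j) / √S) (by
      simp only [div_pow]
      rw [← Finset.sum_div, hq2, ← hS, div_self h.ne'])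
    have h3 : φ (∑ j, (φ (z j) / √S) • z j) ≤ C := by
      have h4 := φ.le_opNorm (∑ j, (φ (z j) / √S) • z j)
      have h5 := le_abs_self (φ (∑ j, (φ (z j) / √S) • z j))
      rw [Real.norm_eq_abs] at h4
      nlinarith [norm_nonneg (∑ j, (φ (z j) / √S) • z j), norm_nonneg φ]
    have h6 : φ (∑ j, (φ (z j) / √S) • z j) = √S := by
      rw [map_sum]
      simp only [map_smul, smul_eq_mul]
      have : ∀ j, φ (z j) / √S * φ (z j) = φ (z j) ^ 2 / √S := fun j => by ring
      simp only [this]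
      rw [← Finset.sum_div, ← hS, div_eq_iff hq.ne', ← sq, hq2]
    rw [h6] at h3
    rw [← hq2]
    exact pow_le_pow_left₀ hq.le h3 2
  have := main_lemma ψ K hK hs hl z hz U hU0 hU (fun _ => C⁻¹) fun φ hφ => by
    simp only [mul_pow]
    rw [← Finset.mul_sum, inv_pow, inv_mul_le_iff₀ (by positivity), mul_one]
    exact s2 φ hφ
  rw [← Finset.smul_sum, norm_smul, Real.norm_of_nonneg (by positivity), inv_mul_le_iff₀ hC1] at this
  nlinarith

/-- prepend an element to a sequence -/
def consq (m : ℕ) (v : ℕ → ℕ) : ℕ → ℕ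
  | 0 => m
  | (i + 1) => v i

/-- iterated ultrafilter on sequences -/
noncomputable def itF : ℕ → Filter (ℕ → ℕ)
  | 0 => pure 0
  | (M + 1) => Filter.bind (hyperfilter ℕ : Filter ℕ) fun m => Filter.map (consq m) (itF M)

/-- iterated ultrafilter on lists -/
noncomputable def itD : ℕ → Ultrafilter (List ℕ)
  | 0 => pure []
  | (l + 1) => Ultrafilter.bind (hyperfilter ℕ) fun m => Ultrafilter.map (fun w => m :: w) (itD l)

theorem itF_ev (M : ℕ) (Q : (ℕ → ℕ) → Prop) :
    (∀ᶠ v in itF (M + 1), Q v) ↔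
      ∀ᶠ m in (hyperfilter ℕ : Filter ℕ), ∀ᶠ v in itF M, Q (consq m v) := by
  rw [itF, Filter.eventually_bind]
  simp only [Filter.eventually_map]

theorem itD_ev (l : ℕ) (Q : List ℕ → Prop) :
    (∀ᶠ w in (itD (l + 1) : Filter (List ℕ)), Q w) ↔
      ∀ᶠ m in (hyperfilter ℕ : Filter ℕ), ∀ᶠ w in (itD l : Filter (List ℕ)), Q (m :: w) := by
  rfl

theorem itF_map (M : ℕ) : ∀ (p : List ℕ), p.Pairwise (· < ·) → (∀ i ∈ p, i < M) →
    ∀ Q : List ℕ → Prop, (∀ᶠ v in itF M, Q (p.map v)) ↔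
      ∀ᶠ w in (itD p.length : Filter (List ℕ)), Q w := by
  induction M with
  | zero =>
    intro p hp hM Q
    have : p = [] := List.eq_nil_iff_forall_not_mem.2 fun i hi => absurd (hM i hi) (by omega)
    subst this
    simp only [itF, itD, List.map_nil, List.length_nil]
    simp
  | succ M ih =>
    have shift : ∀ q : List ℕ, (∀ i ∈ q, 0 < i) → ∃ r : List ℕ, q = r.map Nat.succ := by
      intro q hq
      refine ⟨q.map Nat.pred, ?_⟩
      rw [List.map_map]
      conv_lhs => rw [← List.map_id q]
      refine List.map_congr_left fun i hi => ?_
      have := hq i hi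
      exact (Nat.succ_pred_eq_of_pos this).symm
    have shift2 : ∀ r : List ℕ, (r.map Nat.succ).Pairwise (· < ·) →
        (∀ i ∈ r.map Nat.succ, i < M + 1) → r.Pairwise (· < ·) ∧ ∀ i ∈ r, i < M := by
      intro r h1 h2
      rw [List.pairwise_map] at h1
      refine ⟨h1.imp fun h => Nat.succ_lt_succ_iff.1 h, fun i hi => ?_⟩
      have := h2 _ (List.mem_map_of_mem hi)
      omega
    have shift3 : ∀ (r : List ℕ) (m : ℕ) (v : ℕ → ℕ), (r.map Nat.succ).map (consq m v) = r.map v := by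
      intro r m v
      rw [List.map_map]; rfl
    intro p hp hM Q
    rw [itF_ev]
    rcases p with _ | ⟨i, q⟩
    · simp only [List.map_nil]
      have := ih [] List.Pairwise.nil (by simp) Q
      simp only [List.map_nil] at this
      simp only [this]
      simp
    · rw [List.pairwise_cons] at hp
      rcases Nat.eq_zero_or_pos i with h0 | h0
      · subst h0
        obtain ⟨r, rfl⟩ := shift q hp.1
        obtain ⟨r1, r2⟩ := shift2 r hp.2 fun i hi => hM i (List.mem_cons_of_mem _ hi)
        rw [List.length_cons, itD_ev, List.length_map]
        simp only [List.map_cons, shift3]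
        refine Filter.eventually_congr (Filter.Eventually.of_forall fun m => ?_)
        exact ih r r1 r2 (fun w => Q (m :: w))
      · obtain ⟨r, hr⟩ := shift (i :: q) (by
          intro k hk
          rcases List.mem_cons.1 hk with h | h
          · omega
          · exact h0.trans (hp.1 k h))
        rw [hr] at hM ⊢
        obtain ⟨r1, r2⟩ := shift2 r (by rw [← hr, List.pairwise_cons]; exact hp) hM
        simp only [shift3, List.length_map, ih r r1 r2 Q]
        simp

theorem itF_neBot (M : ℕ) : (itF M).NeBot := by
  by_contra h
  rw [Filter.not_neBot] at h
  have := (itF_map M [] List.Pairwise.nil (by simp) (fun _ => False)).1 (by rw [h]; simp)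
  simp only [Filter.eventually_false_iff_eq_bot] at this
  exact (itD _).neBot.ne this

theorem itF_lim (l : ℕ) (F : List ℕ → ℝ) (B : ℝ) (hF : ∀ w, |F w| ≤ B) :
    ∃ c : ℝ, ∀ (M : ℕ) (p : List ℕ), p.Pairwise (· < ·) → (∀ i ∈ p, i < M) → p.length = l →
      ∀ η > 0, ∀ᶠ v in itF M, |F (p.map v) - c| < η := by
  obtain ⟨c, _, hc⟩ := (isCompact_Icc (a := -B) (b := B)).ultrafilter_le_nhds ((itD l).map F) (by
    rw [Filter.le_principal_iff, Ultrafilter.coe_map, Filter.mem_map]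
    exact Filter.Eventually.of_forall fun w => abs_le.1 (hF w))
  refine ⟨c, fun M p p1 p2 p3 η hη => ?_⟩
  rw [itF_map M p p1 p2 (fun w => |F w - c| < η), p3]
  have : Tendsto F (itD l : Filter (List ℕ)) (𝓝 c) := hc
  exact (Metric.tendsto_nhds.1 this η hη)

theorem itF_ne (M i j : ℕ) (hij : i < j) (hj : j < M) : ∀ᶠ v in itF M, v i ≠ v j := by
  have := (itF_map M [i, j] (by simp [hij]) (by simp; omega) (fun w => w.getD 0 0 ≠ w.getD 1 0)).2 (by
    rw [show [i, j].length = 0 + 1 + 1 from rfl, itD_ev]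
    refine Filter.Eventually.of_forall fun m => ?_
    rw [itD_ev]
    have h1 : ∀ᶠ k in (hyperfilter ℕ : Filter ℕ), k ≠ m := by
      have := Set.Finite.compl_mem_hyperfilter (Set.finite_singleton m)
      exact this
    filter_upwards [h1] with k hk
    refine Filter.Eventually.of_forall fun w => ?_
    simpa using hk.symm)
  simpa using this

/-- block sums -/
noncomputable def blk {X : Type*} [NormedAddCommGroup X] [NormedSpace ℝ X] (y : ℕ → X) (n L : ℕ)
    (a : Fin n → ℝ) (A : Finset (Fin n)) (t : ℕ) : X :=
  ∑ j : Fin n, a j • (y (j * (L + 1) + (if j ∈ A then 0 else t)) -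
    y (j * (L + 1) + (if j ∈ A then 0 else t) + 1))

theorem spread {X : Type*} [NormedAddCommGroup X] [NormedSpace ℝ X] (x : ℕ → X) (R : ℝ)
    (hR : ∀ n, ‖x n‖ ≤ R) (n L : ℕ) (net : Set (Fin n → ℝ)) (hnet : net.Finite) (η : ℝ) (hη : 0 < η) :
    ∃ v : ℕ → ℕ, (∀ j < n * (L + 1), ∀ i < j, v i ≠ v j) ∧
      ∀ a ∈ net, ∀ A : Finset (Fin n), ∀ t < L,
        |‖blk (x ∘ v) n L a A t‖ - ‖blk (x ∘ v) n L a Finset.univ 0‖| < 2 * η := by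
  let F : (Fin n → ℝ) → List ℕ → ℝ := fun a w =>
    ‖∑ j : Fin n, a j • (x (w.getD (2 * j) 0) - x (w.getD (2 * j + 1) 0))‖
  have hF : ∀ a, ∃ c : ℝ, ∀ (M : ℕ) (p : List ℕ), p.Pairwise (· < ·) → (∀ i ∈ p, i < M) →
      p.length = 2 * n → ∀ η > 0, ∀ᶠ v in itF M, |F a (p.map v) - c| < η := by
    intro a
    refine itF_lim (2 * n) (F a) (∑ j, |a j| * (R + R)) fun w => ?_
    rw [abs_of_nonneg (norm_nonneg _)]
    refine (norm_sum_le _ _).trans (Finset.sum_le_sum fun j _ => ?_)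
    rw [norm_smul, Real.norm_eq_abs]
    gcongr
    exact (norm_sub_le _ _).trans (add_le_add (hR _) (hR _))
  choose c hc using hF
  let τ : Finset (Fin n) → ℕ → ℕ → ℕ := fun A t j =>
    if h : j < n then (if (⟨j, h⟩ : Fin n) ∈ A then 0 else t) else 0
  let pos : Finset (Fin n) → ℕ → ℕ → ℕ := fun A t k => (k / 2) * (L + 1) + τ A t (k / 2) + k % 2
  let p : Finset (Fin n) → ℕ → List ℕ := fun A t => (List.range (2 * n)).map (pos A t)
  have hτ : ∀ A t j, τ A t j ≤ t := by
    intro A t j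
    simp only [τ]
    split_ifs <;> omega
  have pmono : ∀ A, ∀ t < L, ∀ k k', k < k' → pos A t k < pos A t k' := by
    intro A t ht k k' hk
    simp only [pos]
    rcases (Nat.div_le_div_right (c := 2) hk.le).eq_or_lt with h | h
    · rw [h]; omega
    · have h1 : (k / 2 + 1) * (L + 1) ≤ (k' / 2) * (L + 1) := Nat.mul_le_mul_right _ h
      rw [add_mul, one_mul] at h1
      have := hτ A t (k / 2)
      omega
  have p1 : ∀ A, ∀ t < L, (p A t).Pairwise (· < ·) := by
    intro A t ht
    simp only [p]
    rw [List.pairwise_map]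
    exact List.pairwise_lt_range.imp fun h => pmono A t ht _ _ h
  have p2 : ∀ A, ∀ t < L, ∀ i ∈ p A t, i < n * (L + 1) := by
    intro A t ht i hi
    simp only [p, List.mem_map, List.mem_range] at hi
    obtain ⟨k, hk, rfl⟩ := hi
    simp only [pos]
    have h1 : (k / 2 + 1) * (L + 1) ≤ n * (L + 1) := Nat.mul_le_mul_right _ (by omega)
    rw [add_mul, one_mul] at h1
    have := hτ A t (k / 2)
    omega
  have pF : ∀ A, ∀ t, ∀ a, ∀ v : ℕ → ℕ, F a ((p A t).map v) = ‖blk (x ∘ v) n L a A t‖ := by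
    intro A t a v
    simp only [F, blk]
    congr 1
    refine Finset.sum_congr rfl fun j _ => ?_
    have hj := j.2
    have g : ∀ k < 2 * n, ((p A t).map v).getD k 0 = v (pos A t k) := by
      intro k hk
      simp only [p]
      rw [List.getD_eq_getElem _ _ (by simpa using hk)]
      simp
    rw [g _ (by omega), g _ (by omega)]
    have e1 : (2 * (j : ℕ)) / 2 = j := by omega
    have e2 : (2 * (j : ℕ) + 1) / 2 = j := by omega
    have e3 : (2 * (j : ℕ)) % 2 = 0 := by omega
    have e4 : (2 * (j : ℕ) + 1) % 2 = 1 := by omega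
    simp only [pos, e1, e2, e3, e4, τ, hj, dif_pos, Function.comp, add_zero, Fin.eta]
  have ev1 : ∀ᶠ v in itF (n * (L + 1)), ∀ j ∈ Finset.range (n * (L + 1)), ∀ i ∈ Finset.range j,
      v i ≠ v j := by
    rw [Filter.eventually_all_finset]
    intro j hj
    rw [Filter.eventually_all_finset]
    intro i hi
    exact itF_ne _ i j (Finset.mem_range.1 hi) (Finset.mem_range.1 hj)
  have ev2 : ∀ᶠ v in itF (n * (L + 1)), ∀ a ∈ net, ∀ A : Finset (Fin n), ∀ t ∈ Finset.range L,
      |F a ((p A t).map v) - c a| < η := by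
    rw [Filter.eventually_all_finite hnet]
    intro a ha
    rw [Filter.eventually_all]
    intro A
    rw [Filter.eventually_all_finset]
    intro t ht
    have ht := Finset.mem_range.1 ht
    exact hc a _ (p A t) (p1 A t ht) (p2 A t ht) (by simp [p]) η hη
  have := itF_neBot (n * (L + 1))
  obtain ⟨v, hv1, hv2⟩ := (ev1.and ev2).exists
  refine ⟨v, fun j hj i hi => hv1 j (Finset.mem_range.2 hj) i (Finset.mem_range.2 hi), ?_⟩
  intro a ha A t ht
  have h1 := hv2 a ha A t (Finset.mem_range.2 ht)
  have h2 := hv2 a ha Finset.univ 0 (Finset.mem_range.2 (by omega))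
  rw [pF] at h1 h2
  rw [abs_lt] at *
  constructor <;> linarith [h1.1, h1.2, h2.1, h2.2]

theorem unc_exists {X : Type*} [NormedAddCommGroup X] [NormedSpace ℝ X]
    (x : ℕ → X) (R : ℝ) (hR1 : 1 < R) (hR : ∀ n, ‖x n‖ ≤ R)
    (hx : Pairwise fun m n => 1 ≤ ‖x m - x n‖) (n : ℕ) :
    ∃ d : Fin n → X, (∀ j, 1 ≤ ‖d j‖) ∧ (∀ j, ‖d j‖ ≤ 2 * R) ∧
      ∀ (ε : Fin n → Bool) (c : Fin n → ℝ),
        ‖∑ j, (sg (ε j) * c j) • d j‖ ≤ 4 * ‖∑ j, c j • d j‖ := by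
  obtain ⟨L, hL⟩ := exists_nat_gt (8 * R * n)
  have hn0 : (0 : ℝ) ≤ n := Nat.cast_nonneg n
  have hL0 : (0 : ℝ) < L := lt_of_le_of_lt (by positivity) hL
  have hL0' : 0 < L := by exact_mod_cast hL0
  obtain ⟨net, _, hnet, hcov⟩ := (isCompact_closedBall (0 : Fin n → ℝ) 1).finite_cover_balls
    (e := 1 / (32 * (n * R + 1))) (by positivity)
  obtain ⟨v, hv1, hv2⟩ := spread x R hR n L net hnet (1 / 16) (by norm_num)
  let y : ℕ → X := x ∘ v
  have hy : ∀ i j, ‖y i - y j‖ ≤ 2 * R := fun i j => by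
    have := norm_sub_le (y i) (y j)
    have h1 : ‖y i‖ ≤ R := hR _
    have h2 : ‖y j‖ ≤ R := hR _
    linarith
  let d : Fin n → X := fun j => y (j * (L + 1)) - y (j * (L + 1) + 1)
  have hd1 : ∀ j, 1 ≤ ‖d j‖ := by
    intro j
    refine hx (hv1 _ ?_ _ (Nat.lt_succ_self _))
    have h1 : ((j : ℕ) + 1) * (L + 1) ≤ n * (L + 1) := Nat.mul_le_mul_right _ j.2
    rw [add_mul, one_mul] at h1
    omega
  have hb0 : ∀ a, blk y n L a Finset.univ 0 = ∑ j, a j • d j := by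
    intro a; simp [blk, d]
  have close : ∀ (a b : Fin n → ℝ), dist a b < 1 / (32 * (n * R + 1)) → ∀ A t,
      |‖blk y n L a A t‖ - ‖blk y n L b A t‖| ≤ 1 / 16 := by
    intro a b hab A t
    refine (abs_norm_sub_norm_le _ _).trans ?_
    rw [blk, blk, ← Finset.sum_sub_distrib]
    calc _ ≤ ∑ j : Fin n, (1 / (32 * (n * R + 1))) * (2 * R) := by
          refine (norm_sum_le _ _).trans (Finset.sum_le_sum fun j _ => ?_)
          rw [← sub_smul, norm_smul]
          refine mul_le_mul ?_ (hy _ _) (norm_nonneg _) (by positivity)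
          rw [← dist_eq_norm]
          exact (dist_le_pi_dist a b j).trans hab.le
      _ ≤ 1 / 16 := by
          rw [Finset.sum_const, Finset.card_univ, Fintype.card_fin, nsmul_eq_mul]
          have : (0 : ℝ) < n * R + 1 := by positivity
          rw [one_div, inv_mul_eq_div, ← mul_div_assoc, div_le_div_iff₀ (by positivity) (by norm_num)]
          nlinarith
  have s1 : ∀ a : Fin n → ℝ, (∀ j, |a j| ≤ 1) → ∀ A, ∀ t < L,
      ‖blk y n L a A t‖ ≤ ‖∑ j, a j • d j‖ + 1 / 4 := by
    intro a ha A t ht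
    have : a ∈ Metric.closedBall (0 : Fin n → ℝ) 1 := by
      rw [mem_closedBall_zero_iff, pi_norm_le_iff_of_nonneg zero_le_one]
      exact ha
    obtain ⟨b, hb, hab⟩ := Set.mem_iUnion₂.1 (hcov this)
    rw [Metric.mem_ball] at hab
    have h1 := abs_le.1 (close a b hab A t)
    have h2 := abs_le.1 (close a b hab Finset.univ 0)
    have h3 := abs_lt.1 (hv2 b hb A t ht)
    rw [← hb0]
    simp only [y] at *
    linarith [h1.2, h2.1, h3.2]
  have s2 : ∀ a : Fin n → ℝ, (∀ j, |a j| ≤ 1) → ∀ A : Finset (Fin n),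
      ‖∑ j, if j ∈ A then a j • d j else 0‖ ≤ ‖∑ j, a j • d j‖ + 1 / 2 := by
    intro a ha A
    set SA := ∑ j, if j ∈ A then a j • d j else 0 with hSA
    set rem := ∑ j : Fin n, (if j ∈ A then 0 else a j • (y (j * (L + 1)) - y (j * (L + 1) + L)))
      with hrem
    have e : ∑ t ∈ Finset.range L, blk y n L a A t = (L : ℝ) • SA + rem := by
      simp only [blk]
      rw [Finset.sum_comm, hSA, hrem, Finset.smul_sum, ← Finset.sum_add_distrib]
      refine Finset.sum_congr rfl fun j _ => ?_
      by_cases hj : j ∈ A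
      · simp only [hj, if_true, add_zero, Finset.sum_const, Finset.card_range, d]
        rw [← Nat.cast_smul_eq_nsmul ℝ]
      · simp only [hj, if_false, smul_zero, zero_add]
        rw [← Finset.smul_sum]
        have := Finset.sum_range_sub' (fun t => y (j * (L + 1) + t)) L
        simp only [add_zero, ← add_assoc] at this
        rw [this]
    have hr : ‖rem‖ ≤ n * (2 * R) := by
      calc ‖rem‖ ≤ ∑ j : Fin n, 2 * R := by
            refine (norm_sum_le _ _).trans (Finset.sum_le_sum fun j _ => ?_)
            split_ifs
            · rw [norm_zero]; linarith
            · rw [norm_smul]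
              have h1 := hy (j * (L + 1)) (j * (L + 1) + L)
              have h2 := ha j
              rw [← Real.norm_eq_abs] at h2
              nlinarith [norm_nonneg (a j), norm_nonneg (y (j * (L + 1)) - y (j * (L + 1) + L))]
        _ = n * (2 * R) := by simp
    have hs : ‖∑ t ∈ Finset.range L, blk y n L a A t‖ ≤ L * (‖∑ j, a j • d j‖ + 1 / 4) := by
      calc _ ≤ ∑ t ∈ Finset.range L, (‖∑ j, a j • d j‖ + 1 / 4) :=
            (norm_sum_le _ _).trans (Finset.sum_le_sum fun t ht => s1 a ha A t (Finset.mem_range.1 ht))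
        _ = _ := by simp; ring
    rw [e] at hs
    have h5 : ‖(L : ℝ) • SA‖ ≤ ‖(L : ℝ) • SA + rem‖ + ‖rem‖ := by
      have := norm_sub_le ((L : ℝ) • SA + rem) rem
      rwa [add_sub_cancel_right] at this
    rw [norm_smul, Real.norm_of_nonneg hL0.le] at h5
    refine le_of_mul_le_mul_left ?_ hL0
    nlinarith
  have s3 : ∀ (c : Fin n → ℝ) (A : Finset (Fin n)),
      ‖∑ j, if j ∈ A then c j • d j else 0‖ ≤ 2 * ‖∑ j, c j • d j‖ := by
    intro c A
    by_cases hc : ∀ j, c j = 0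
    · simp [hc]
    push Not at hc
    obtain ⟨j1, hj1⟩ := hc
    have : Nonempty (Fin n) := ⟨j1⟩
    obtain ⟨j0, hj0⟩ := Finite.exists_max (fun j => |c j|)
    have hm : 0 < |c j0| := lt_of_lt_of_le (abs_pos.2 hj1) (hj0 j1)
    set m := |c j0| with hmdef
    let a : Fin n → ℝ := fun j => m⁻¹ * c j
    have ha : ∀ j, |a j| ≤ 1 := by
      intro j
      simp only [a]
      rw [abs_mul, abs_of_pos (inv_pos.2 hm), inv_mul_le_iff₀ hm, mul_one]
      exact hj0 j
    have q1 := s2 a ha {j0}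
    have q2 := s2 a ha A
    have ea : ∑ j, a j • d j = m⁻¹ • ∑ j, c j • d j := by
      simp only [a, Finset.smul_sum, smul_smul]
    have eA : (∑ j, if j ∈ A then a j • d j else 0) = m⁻¹ • ∑ j, if j ∈ A then c j • d j else 0 := by
      simp only [a, Finset.smul_sum, smul_smul, smul_ite, smul_zero]
    have e0 : (∑ j, if j ∈ ({j0} : Finset (Fin n)) then a j • d j else 0) = a j0 • d j0 := by
      simp
    have n0 : 1 ≤ ‖a j0 • d j0‖ := by
      rw [norm_smul, Real.norm_eq_abs]
      have : |a j0| = 1 := by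
        simp only [a]
        rw [abs_mul, abs_of_pos (inv_pos.2 hm), ← hmdef, inv_mul_cancel₀ hm.ne']
      rw [this, one_mul]; exact hd1 j0
    rw [e0] at q1
    have q3 : ‖∑ j, if j ∈ A then a j • d j else 0‖ ≤ 2 * ‖∑ j, a j • d j‖ := by linarith
    rw [ea, eA, norm_smul, norm_smul, Real.norm_of_nonneg (inv_nonneg.2 hm.le)] at q3
    have : 0 < m⁻¹ := inv_pos.2 hm
    refine le_of_mul_le_mul_left ?_ this
    linarith
  refine ⟨d, hd1, fun j => hy _ _, fun ε c => ?_⟩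
  let A : Finset (Fin n) := Finset.univ.filter fun j => ε j = true
  have e : ∑ j, (sg (ε j) * c j) • d j =
      (∑ j, if j ∈ A then c j • d j else 0) - ∑ j, if j ∈ Aᶜ then c j • d j else 0 := by
    rw [← Finset.sum_sub_distrib]
    refine Finset.sum_congr rfl fun j _ => ?_
    cases h : ε j <;> simp [A, h, sg]
  rw [e]
  have := norm_sub_le (∑ j, if j ∈ A then c j • d j else 0) (∑ j, if j ∈ Aᶜ then c j • d j else 0)
  linarith [s3 c A, s3 c Aᶜ]

theorem ell_one {X : Type*} [NormedAddCommGroup X] [NormedSpace ℝ X]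
    (ψ : Set X → X) (K : ℝ) (hK : 0 ≤ K)
    (hs : ∀ A : Set X, A.Nonempty → IsClosed A → IsBounded A → Convex ℝ A → ψ A ∈ A)
    (hl : ∀ A B : Set X,
        A.Nonempty → IsClosed A → IsBounded A → Convex ℝ A →
        B.Nonempty → IsClosed B → IsBounded B → Convex ℝ B →
        ‖ψ A - ψ B‖ ≤ K * Metric.hausdorffDist A B)
    (x : ℕ → X) (R : ℝ) (hR1 : 1 < R) (hR : ∀ n, ‖x n‖ ≤ R)
    (hx : Pairwise fun m n => 1 ≤ ‖x m - x n‖) (k : ℕ) :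
    ∃ w : Fin k → X, ∀ a : Fin k → ℝ,
      ‖∑ j, a j • w j‖ ≤ 3 * (2 * K * 4 + 1) ^ 2 * ∑ j, |a j| ∧
      ∑ j, |a j| ≤ 5 * R * ‖∑ j, a j • w j‖ := by
  obtain ⟨d, d1, d2, d3⟩ := unc_exists x R hR1 hR hx (Fintype.card (Fin k → Bool))
  let e := Fintype.equivFin (Fin k → Bool)
  have hR0 : 0 < 2 * R := by linarith
  set z : (Fin k → Bool) → X := fun i => (2 * R)⁻¹ • d (e i) with hz
  set C := (2 * K * 4 + 1) ^ 2 with hC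
  have hC0 : 0 < C := by positivity
  have z1 : ∀ i, (2 * R)⁻¹ ≤ ‖z i‖ := by
    intro i
    rw [hz, norm_smul, Real.norm_of_nonneg (by positivity)]
    exact le_mul_of_one_le_right (by positivity) (d1 _)
  have z2 : ∀ i, ‖z i‖ ≤ 1 := by
    intro i
    rw [hz, norm_smul, Real.norm_of_nonneg (by positivity), inv_mul_le_iff₀ hR0, mul_one]
    exact d2 _
  have zsum : ∀ c : (Fin k → Bool) → ℝ, ∑ i, c i • z i = (2 * R)⁻¹ • ∑ j, c (e.symm j) • d j := by
    intro c
    rw [← e.sum_comp, Finset.smul_sum]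
    refine Finset.sum_congr rfl fun i _ => ?_
    simp only [hz, Equiv.symm_apply_apply]
    rw [smul_comm]
  have z3 : ∀ (ε : (Fin k → Bool) → Bool) (c : (Fin k → Bool) → ℝ),
      ‖∑ i, (sg (ε i) * c i) • z i‖ ≤ 4 * ‖∑ i, c i • z i‖ := by
    intro ε c
    rw [zsum, zsum, norm_smul, norm_smul]
    have := d3 (fun j => ε (e.symm j)) (fun j => c (e.symm j))
    nlinarith [norm_nonneg ((2 * R)⁻¹ : ℝ)]
  clear_value z
  have u1 : ∀ c : (Fin k → Bool) → ℝ, (∀ i, c i ≠ 0) → (∀ i, |c i| ≤ 3) →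
      ‖∑ i, c i • z i‖ ≤ 3 * C := by
    intro c c0 c3
    have := main_cor ψ K hK hs hl (fun i => (c i / 3) • z i) (fun i => smul_ne_zero
      (div_ne_zero (c0 i) (by norm_num)) (by
        intro h
        have := z1 i
        rw [h, norm_zero] at this
        have : 0 < (2 * R)⁻¹ := by positivity
        linarith)) (fun i => by
        rw [norm_smul, Real.norm_eq_abs, abs_div, abs_of_pos (by norm_num : (0 : ℝ) < 3)]
        have h1 := z2 i
        have h2 : |c i| / 3 ≤ 1 := by linarith [c3 i]
        exact mul_le_one₀ h2 (norm_nonneg _) h1) 4 (by norm_num) (fun ε b => by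
        have := z3 ε (fun i => b i * (c i / 3))
        simpa only [smul_smul, mul_assoc] using this)
    have e3 : ∑ i, (c i / 3) • z i = (3 : ℝ)⁻¹ • ∑ i, c i • z i := by
      rw [Finset.smul_sum]
      refine Finset.sum_congr rfl fun i _ => ?_
      rw [smul_smul]; congr 1; ring
    rw [e3, norm_smul, Real.norm_of_nonneg (by norm_num), ← hC] at this
    linarith
  have u2 : ∀ c : (Fin k → Bool) → ℝ, (∀ i, |c i| ≤ 1) → ‖∑ i, c i • z i‖ ≤ 3 * C := by
    intro c hc
    have h1 := u1 (fun i => c i + 2) (fun i => by have := abs_le.1 (hc i); linarith [this.1])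
      (fun i => by have := abs_le.1 (hc i); rw [abs_le]; constructor <;> linarith [this.1, this.2])
    have h2 := u1 (fun i => c i - 2) (fun i => by have := abs_le.1 (hc i); linarith [this.2])
      (fun i => by have := abs_le.1 (hc i); rw [abs_le]; constructor <;> linarith [this.1, this.2])
    have h3 : (2 : ℝ) • ∑ i, c i • z i = ∑ i, (c i + 2) • z i + ∑ i, (c i - 2) • z i := by
      rw [Finset.smul_sum, ← Finset.sum_add_distrib]
      refine Finset.sum_congr rfl fun i _ => ?_
      rw [smul_smul, ← add_smul]; congr 1; ring
    have h4 := norm_add_le (∑ i, (c i + 2) • z i) (∑ i, (c i - 2) • z i)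
    rw [← h3, norm_smul, Real.norm_of_nonneg (by norm_num)] at h4
    linarith
  have u3 : ∀ (c : (Fin k → Bool) → ℝ) (m : ℝ), 0 ≤ m → (∀ i, |c i| ≤ m) →
      ‖∑ i, c i • z i‖ ≤ 3 * C * m := by
    intro c m hm hc
    rcases hm.eq_or_lt with h | h
    · have : ∀ i, c i = 0 := fun i => abs_nonpos_iff.1 (by rw [h]; exact hc i)
      simp [this, ← h]
    · have := u2 (fun i => m⁻¹ * c i) (fun i => by
        rw [abs_mul, abs_of_pos (inv_pos.2 h), inv_mul_le_iff₀ h, mul_one]; exact hc i)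
      have e4 : ∑ i, (m⁻¹ * c i) • z i = m⁻¹ • ∑ i, c i • z i := by
        rw [Finset.smul_sum]; simp only [smul_smul]
      rw [e4, norm_smul, Real.norm_of_nonneg (by positivity), inv_mul_le_iff₀ h] at this
      linarith
  have low : ∀ (c : (Fin k → Bool) → ℝ) (i : Fin k → Bool), |c i| ≤ 5 * R * ‖∑ i, c i • z i‖ := by
    intro c i
    have h1 := z3 (fun l => decide (l = i)) c
    have h3 : ∀ l, ((sg (decide (l = i)) * c l) • z l + c l • z l) =
        if l = i then (2 * c l) • z l else 0 := by
      intro l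
      by_cases hj : l = i
      · simp only [hj, decide_true, sg, if_true, one_mul]
        rw [← add_smul]; congr 1; ring
      · simp [hj, sg]
    have h2 : ∑ l, (sg (decide (l = i)) * c l) • z l + ∑ l, c l • z l = (2 * c i) • z i := by
      rw [← Finset.sum_add_distrib]
      simp only [h3, Finset.sum_ite_eq', Finset.mem_univ, if_true]
    have h4 := norm_add_le (∑ l, (sg (decide (l = i)) * c l) • z l) (∑ l, c l • z l)
    rw [h2, norm_smul, Real.norm_eq_abs, abs_mul, abs_two] at h4
    have h5 : 2 * |c i| * (2 * R)⁻¹ ≤ 2 * |c i| * ‖z i‖ := by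
      gcongr; exact z1 i
    have h6 : 2 * |c i| * (2 * R)⁻¹ ≤ 5 * ‖∑ l, c l • z l‖ := by linarith
    rw [← div_eq_mul_inv, div_le_iff₀ hR0] at h6
    linarith
  have key : ∀ a : Fin k → ℝ, ∑ j, a j • ∑ i : Fin k → Bool, sg (i j) • z i =
      ∑ i : Fin k → Bool, (∑ j, a j * sg (i j)) • z i := by
    intro a
    simp only [Finset.smul_sum, Finset.sum_smul, smul_smul]
    rw [Finset.sum_comm]
  refine ⟨fun j => ∑ i : Fin k → Bool, sg (i j) • z i, fun a => ⟨?_, ?_⟩⟩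
  · rw [key]
    refine u3 _ _ (Finset.sum_nonneg fun _ _ => abs_nonneg _) fun i => ?_
    refine (Finset.abs_sum_le_sum_abs _ _).trans (Finset.sum_le_sum fun j _ => ?_)
    rw [abs_mul]
    cases i j <;> simp [sg]
  · rw [key]
    have := low (fun i => ∑ j, a j * sg (i j)) (fun j => decide (0 ≤ a j))
    refine le_trans ?_ this
    refine le_trans (Finset.sum_le_sum fun j _ => ?_) (le_abs_self _)
    by_cases h : 0 ≤ a j
    · simp [h, sg, abs_of_nonneg]
    · simp [h, sg, abs_of_neg (not_le.1 h)]

end helpers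


/-- (Positselskii; Przesławski–Yost) For an infinite-dimensional Banach space `X`, there is
no Lipschitz selector on the collection `H(X)` of nonempty, closed, bounded, convex subsets
of `X` equipped with the Hausdorff distance. -/
theorem no_lipschitz_selector_of_infinite_dimensional
    {X : Type*} [NormedAddCommGroup X] [NormedSpace ℝ X] [CompleteSpace X]
    (hX : ¬ FiniteDimensional ℝ X) :
    ¬ ∃ (ψ : Set X → X) (K : ℝ), 0 ≤ K ∧
      (∀ A : Set X, A.Nonempty → IsClosed A → IsBounded A → Convex ℝ A → ψ A ∈ A) ∧
      (∀ A B : Set X,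
        A.Nonempty → IsClosed A → IsBounded A → Convex ℝ A →
        B.Nonempty → IsClosed B → IsBounded B → Convex ℝ B →
        ‖ψ A - ψ B‖ ≤ K * Metric.hausdorffDist A B) := by
  rintro ⟨ψ, K, hK, hs, hl⟩
  obtain ⟨R, x, hR1, hR, hx⟩ := exists_seq_norm_le_one_le_norm_sub hX
  set D : ℝ := 3 * (2 * K * 4 + 1) ^ 2 with hD
  have hD0 : 0 < D := by positivity
  have hR0 : 0 < R := by linarith
  obtain ⟨k, hk⟩ := exists_nat_gt (5 * R * (D * (2 * K * (D * (5 * R)) + 1) ^ 2))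
  obtain ⟨w, hw⟩ := ell_one ψ K hK hs hl x R hR1 hR hx k
  simp only [← hD] at hw
  clear_value D
  have sgl : ∀ j, w j = ∑ i, (Pi.single j (1 : ℝ) : Fin k → ℝ) i • w i := by
    intro j
    rw [Finset.sum_eq_single j]
    · simp
    · intro b _ hb; simp [hb]
    · simp
  have sgl2 : ∀ j : Fin k, ∑ i, |(Pi.single j (1 : ℝ) : Fin k → ℝ) i| = 1 := by
    intro j
    rw [Finset.sum_eq_single j]
    · simp
    · intro b _ hb; simp [hb]
    · simp
  have esum : ∀ c : Fin k → ℝ, ∑ j, c j • (D⁻¹ • w j) = D⁻¹ • ∑ j, c j • w j := by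
    intro c
    rw [Finset.smul_sum]
    exact Finset.sum_congr rfl fun j _ => smul_comm _ _ _
  have fin := main_cor ψ K hK hs hl (fun j => D⁻¹ • w j) (fun j h => by
      have h1 := (hw (Pi.single j (1 : ℝ))).2
      rw [sgl2, ← sgl] at h1
      rcases smul_eq_zero.1 h with h | h
      · exact (inv_pos.2 hD0).ne' h
      · rw [h, norm_zero, mul_zero] at h1; linarith) (fun j => by
      have h1 := (hw (Pi.single j (1 : ℝ))).1
      rw [sgl2, ← sgl, mul_one] at h1
      rw [norm_smul, Real.norm_of_nonneg (by positivity), inv_mul_le_iff₀ hD0, mul_one]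
      exact h1) (D * (5 * R)) (by positivity) (fun ε c => by
      rw [esum (fun j => sg (ε j) * c j), esum c, norm_smul, norm_smul, mul_left_comm]
      gcongr
      have h1 := (hw (fun j => sg (ε j) * c j)).1
      have h2 := (hw c).2
      have h3 : ∀ j, |sg (ε j) * c j| = |c j| := by
        intro j
        cases ε j <;> simp [sg]
      simp only [h3] at h1
      refine h1.trans ?_
      rw [mul_assoc]
      exact mul_le_mul_of_nonneg_left h2 hD0.le)
  have h1 := (hw (fun _ => 1)).2
  simp only [abs_one, Finset.sum_const, Finset.card_univ, Fintype.card_fin, nsmul_eq_mul, mul_one,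
    one_smul] at h1
  rw [← Finset.smul_sum, norm_smul, Real.norm_of_nonneg (by positivity), inv_mul_le_iff₀ hD0] at fin
  have h2 : 5 * R * ‖∑ j, w j‖ ≤ 5 * R * (D * (2 * K * (D * (5 * R)) + 1) ^ 2) := by gcongr
  linarith
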